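/- Let I ⊆ S be a squarefree monomial ideal with minimal primary decomposition I = I_{α_1} ∩ ⋯ ∩ I_{α_r} satisfying I_{α_1} + ⋯ + I_{α_r} = (x_1,…,x_n). Fix e ≥ 0, q = p^e, and suppose J_q ≠ 0. If x^{γ} and x^{γ'} are minimal monomial generators of J_q with supp(γ') strictly contained in supp(γ), then there exists an index k with deg_{x_k}(x^{γ}) = q−1 and deg_{x_k}(x^{γ'}) = q. -/

import Mathlib

noncomputable section

/-- The `q`-th Frobenius power of an ideal: the ideal generated by `{f^q : f ∈ I}`. -/
def frobPow {R : Type*} [CommRing R] (q : ℕ) (I : Ideal R) : Ideal R :=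
  Ideal.span ((fun f => f ^ q) '' (I : Set R))

/-- The monomial `x^γ = x_1^{γ_1} ⋯ x_n^{γ_n}` in `k[[x_1,…,x_n]]`. -/
def mon (k : Type*) [Field k] {n : ℕ} (γ : Fin n → ℕ) : MvPowerSeries (Fin n) k :=
  ∏ i, (MvPowerSeries.X i : MvPowerSeries (Fin n) k) ^ γ i

/-- The face ideal `I_α`, generated by the variables `x_i` with `α i = 1`. -/
def faceIdeal (k : Type*) [Field k] {n : ℕ} (α : Fin n → ℕ) :
    Ideal (MvPowerSeries (Fin n) k) :=
  Ideal.span {f | ∃ i, α i = 1 ∧ f = MvPowerSeries.X i}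

/-- `I = I_{α_1} ∩ ⋯ ∩ I_{α_r}` is the minimal primary decomposition of the squarefree
monomial ideal `I` into face ideals: each `α j` is a nonzero `{0,1}`-vector, `I` is the
intersection of the face ideals `I_{α j}`, and the decomposition is irredundant (the
supports of the `α j` are pairwise incomparable). -/
def IsMinFaceDecomp (k : Type*) [Field k] {n r : ℕ} (α : Fin r → Fin n → ℕ)
    (I : Ideal (MvPowerSeries (Fin n) k)) : Prop :=
  (∀ j i, α j i = 0 ∨ α j i = 1) ∧ (∀ j, α j ≠ 0) ∧
    I = ⨅ j, faceIdeal k (α j) ∧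
    ∀ j l, j ≠ l → ¬ ({i | α j i = 1} ⊆ {i | α l i = 1})

/-- `x^γ` is a minimal monomial generator of the monomial ideal `J`: `x^γ ∈ J` and no
monomial properly dividing `x^γ` belongs to `J`. -/
def IsMinGen (k : Type*) [Field k] {n : ℕ} (J : Ideal (MvPowerSeries (Fin n) k))
    (γ : Fin n → ℕ) : Prop :=
  mon k γ ∈ J ∧ ∀ δ : Fin n → ℕ, (∀ i, δ i ≤ γ i) → δ ≠ γ → mon k δ ∉ J

/-- `J_q`: the unique minimal monomial ideal with
`(I^{[q]} :_S I) = I^{[q]} + J_q + ((x_1⋯x_n)^{q-1})`; equivalently, the ideal generated by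
those minimal monomial generators of `(I^{[q]} :_S I)` lying neither in `I^{[q]}` nor in
the principal ideal `((x_1⋯x_n)^{q-1})`. -/
def Jideal (k : Type*) [Field k] {n : ℕ} (q : ℕ) (I : Ideal (MvPowerSeries (Fin n) k)) :
    Ideal (MvPowerSeries (Fin n) k) :=
  Ideal.span (mon k '' {γ | IsMinGen k ((frobPow q I).colon I) γ ∧
    mon k γ ∉ frobPow q I ∧ mon k γ ∉ Ideal.span {mon k (fun _ => 1) ^ (q - 1)}})

open MvPowerSeries in
theorem mon_eq_monomial (k : Type*) [Field k] {n : ℕ} (γ : Fin n → ℕ) :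
    mon k γ = monomial (Finsupp.equivFunOnFinite.symm γ) 1 := by
  simp only [mon, X_pow_eq, prod_monomial, Finset.prod_const_one]
  congr
  ext i
  simp [Finsupp.finsetSum_apply, Finsupp.single_apply]

theorem mon_mul_mon (k : Type*) [Field k] {n : ℕ} (γ δ : Fin n → ℕ) :
    mon k γ * mon k δ = mon k (γ + δ) := by
  simp [mon, ← Finset.prod_mul_distrib, pow_add]

theorem mon_pow (k : Type*) [Field k] {n : ℕ} (γ : Fin n → ℕ) (q : ℕ) :
    mon k γ ^ q = mon k (q • γ) := by
  simp [mon, ← Finset.prod_pow, ← pow_mul, mul_comm]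

theorem mon_dvd_mon (k : Type*) [Field k] {n : ℕ} {γ δ : Fin n → ℕ} (h : γ ≤ δ) :
    mon k γ ∣ mon k δ :=
  ⟨mon k (δ - γ), by rw [mon_mul_mon, add_tsub_cancel_of_le h]⟩

/-- Every exponent occurring in an element of a monomial ideal is divisible by a generator. -/
theorem exists_le_of_mem_span_mon {k : Type*} [Field k] {n : ℕ} {D : Set (Fin n → ℕ)}
    {f : MvPowerSeries (Fin n) k} (hf : f ∈ Ideal.span (mon k '' D)) {m : Fin n →₀ ℕ}
    (hm : MvPowerSeries.coeff m f ≠ 0) : ∃ δ ∈ D, δ ≤ ⇑m := by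
  classical
  induction hf using Submodule.span_induction generalizing m with
  | mem x hx =>
    obtain ⟨δ, hδ, rfl⟩ := hx
    rw [mon_eq_monomial, MvPowerSeries.coeff_monomial] at hm
    refine ⟨δ, hδ, ?_⟩
    split_ifs at hm with h
    · simp [h]
    · exact absurd rfl hm
  | zero => simp at hm
  | add x y _ _ ihx ihy =>
    by_cases hx : MvPowerSeries.coeff m x = 0
    · exact ihy (by simpa [hx] using hm)
    · exact ihx hx
  | smul a x _ ih =>
    rw [smul_eq_mul, MvPowerSeries.coeff_mul] at hm
    obtain ⟨c, hc, hne⟩ := Finset.exists_ne_zero_of_sum_ne_zero hm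
    obtain ⟨δ, hδ, hle⟩ := ih (right_ne_zero_of_mul hne)
    refine ⟨δ, hδ, fun i => (hle i).trans ?_⟩
    rw [← Finset.HasAntidiagonal.mem_antidiagonal.mp hc]
    simp

theorem mon_mem_span_mon {k : Type*} [Field k] {n : ℕ} {D : Set (Fin n → ℕ)}
    {γ : Fin n → ℕ} : mon k γ ∈ Ideal.span (mon k '' D) ↔ ∃ δ ∈ D, δ ≤ γ := by
  classical
  constructor
  · intro h
    simpa using exists_le_of_mem_span_mon h
      (m := Finsupp.equivFunOnFinite.symm γ) (by simp [mon_eq_monomial])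
  · rintro ⟨δ, hδ, hle⟩
    exact Ideal.mem_of_dvd _ (mon_dvd_mon k hle) (Ideal.subset_span ⟨δ, hδ, rfl⟩)

theorem faceIdeal_eq_span_mon (k : Type*) [Field k] {n : ℕ} (α : Fin n → ℕ) :
    faceIdeal k α = Ideal.span (mon k '' {δ | ∃ i, α i = 1 ∧ δ = Pi.single i 1}) := by
  have hX (i : Fin n) : mon k (Pi.single i 1) = MvPowerSeries.X i := by
    rw [mon, Finset.prod_eq_single i] <;> simp +contextual
  rw [faceIdeal]
  congr 1
  ext f
  constructor
  · rintro ⟨i, hi, rfl⟩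
    exact ⟨_, ⟨i, hi, rfl⟩, hX i⟩
  · rintro ⟨_, ⟨i, hi, rfl⟩, rfl⟩
    exact ⟨i, hi, hX i⟩

/-- The squarefree exponent vector with support `A`. -/
def squarefreeExp {n : ℕ} (A : Finset (Fin n)) : Fin n → ℕ := fun i => if i ∈ A then 1 else 0

theorem squarefreeExp_support_mem_iInf_faceIdeal {k : Type*} [Field k] {n r : ℕ}
    {α : Fin r → Fin n → ℕ} {f : MvPowerSeries (Fin n) k} (hf : f ∈ ⨅ j, faceIdeal k (α j))
    {m : Fin n →₀ ℕ} (hm : MvPowerSeries.coeff m f ≠ 0) :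
    mon k (squarefreeExp m.support) ∈ ⨅ j, faceIdeal k (α j) := by
  rw [Ideal.mem_iInf] at hf ⊢
  intro j
  have hj := hf j
  rw [faceIdeal_eq_span_mon] at hj ⊢
  obtain ⟨_, ⟨i, hi, rfl⟩, hle⟩ := exists_le_of_mem_span_mon hj hm
  have hmi : m i ≠ 0 := by
    have : Pi.single (M := fun _ => ℕ) i 1 i ≤ m i := hle i
    rw [Pi.single_eq_same] at this
    omega
  refine mon_mem_span_mon.mpr ⟨_, ⟨i, hi, rfl⟩, fun l => ?_⟩
  obtain rfl | hl := eq_or_ne l i <;> simp [squarefreeExp, *]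

/-- The quotient by `x^A` of the part of `f` consisting of the terms with support `A`. -/
def supportPart {k : Type*} [Field k] {n : ℕ} (f : MvPowerSeries (Fin n) k)
    (A : Finset (Fin n)) : MvPowerSeries (Fin n) k := fun m =>
  if (m + Finsupp.equivFunOnFinite.symm (squarefreeExp A)).support = A then
    MvPowerSeries.coeff (m + Finsupp.equivFunOnFinite.symm (squarefreeExp A)) f else 0

theorem eq_sum_squarefreeExp_mul {k : Type*} [Field k] {n : ℕ} (f : MvPowerSeries (Fin n) k) :
    f = ∑ A : Finset (Fin n), mon k (squarefreeExp A) * supportPart f A := by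
  classical
  ext m
  have hle : Finsupp.equivFunOnFinite.symm (squarefreeExp m.support) ≤ m := by
    intro i
    by_cases hi : m i = 0 <;> simp [squarefreeExp, hi]
    omega
  rw [map_sum, Finset.sum_eq_single m.support]
  · rw [mon_eq_monomial, MvPowerSeries.coeff_monomial_mul, if_pos hle, one_mul,
      MvPowerSeries.coeff_apply _ (m - _), supportPart, tsub_add_cancel_of_le hle, if_pos rfl]
  · intro A _ hA
    rw [mon_eq_monomial, MvPowerSeries.coeff_monomial_mul]
    split_ifs with h
    · rw [one_mul, MvPowerSeries.coeff_apply (supportPart f A), supportPart, tsub_add_cancel_of_le h, if_neg hA.symm]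
    · rfl
  · simp

theorem iInf_faceIdeal_eq_span_mon (k : Type*) [Field k] {n r : ℕ} (α : Fin r → Fin n → ℕ) :
    ∃ T : Set (Finset (Fin n)),
      ⨅ j, faceIdeal k (α j) = Ideal.span (mon k '' (squarefreeExp '' T)) := by
  set I := ⨅ j, faceIdeal k (α j)
  refine ⟨{A | mon k (squarefreeExp A) ∈ I}, le_antisymm (fun f hf => ?_) ?_⟩
  · rw [eq_sum_squarefreeExp_mul f]
    refine Ideal.sum_mem _ fun A _ => ?_
    by_cases hA : mon k (squarefreeExp A) ∈ I
    · exact Ideal.mul_mem_right _ _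
        (Ideal.subset_span (Set.mem_image_of_mem _ (Set.mem_image_of_mem _ hA)))
    · convert Ideal.zero_mem _
      convert mul_zero _
      ext m
      rw [MvPowerSeries.coeff_apply, supportPart, map_zero]
      split_ifs with h
      · by_contra hne
        have := squarefreeExp_support_mem_iInf_faceIdeal hf hne
        rw [h] at this
        exact hA this
      · rfl
  · rw [Ideal.span_le]
    rintro _ ⟨_, ⟨A, hA, rfl⟩, rfl⟩
    exact hA

theorem frobPow_span (R : Type*) [CommRing R] (p : ℕ) [ExpChar R p] (e : ℕ) (s : Set R) :
    frobPow (p ^ e) (Ideal.span s) = Ideal.span ((fun f => f ^ p ^ e) '' s) :=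
  Ideal.map_span (iterateFrobenius R p e) s

theorem frobPow_span_mon (p : ℕ) [Fact p.Prime] (k : Type*) [Field k] [CharP k p] {n : ℕ}
    (e : ℕ) (D : Set (Fin n → ℕ)) :
    frobPow (p ^ e) (Ideal.span (mon k '' D)) =
      Ideal.span (mon k '' ((fun δ => p ^ e • δ) '' D)) := by
  have : ExpChar k p := ExpChar.prime Fact.out
  have : ExpChar (MvPowerSeries (Fin n) k) p :=
    expChar_of_injective_algebraMap (algebraMap k (MvPowerSeries (Fin n) k)).injective p
  rw [frobPow_span, Set.image_image, Set.image_image]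
  simp only [mon_pow]

theorem mon_mem_colon_frobPow_iff (p : ℕ) [Fact p.Prime] (k : Type*) [Field k] [CharP k p]
    {n : ℕ} (e : ℕ) (D : Set (Fin n → ℕ)) (γ : Fin n → ℕ) :
    mon k γ ∈ (frobPow (p ^ e) (Ideal.span (mon k '' D))).colon (Ideal.span (mon k '' D)) ↔
      ∀ δ ∈ D, ∃ ε ∈ D, p ^ e • ε ≤ γ + δ := by
  rw [Ideal.span, Submodule.colon_span, ← Ideal.span, frobPow_span_mon, Submodule.mem_colon]
  simp [mon_mul_mon, mon_mem_span_mon]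

/-- Round down to the largest element of `{0, q - 1, q}`. -/
def frobTrunc (q m : ℕ) : ℕ := if q ≤ m then q else if q - 1 ≤ m then q - 1 else 0

theorem frobTrunc_le (q m : ℕ) : frobTrunc q m ≤ m := by
  unfold frobTrunc
  split_ifs <;> omega

theorem mon_frobTrunc_mem_colon (p : ℕ) [Fact p.Prime] (k : Type*) [Field k] [CharP k p]
    {n : ℕ} (e : ℕ) (T : Set (Finset (Fin n))) {I : Ideal (MvPowerSeries (Fin n) k)}
    (hI : I = Ideal.span (mon k '' (squarefreeExp '' T))) {γ : Fin n → ℕ}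
    (hγ : mon k γ ∈ (frobPow (p ^ e) I).colon I) :
    mon k (fun i => frobTrunc (p ^ e) (γ i)) ∈ (frobPow (p ^ e) I).colon I := by
  subst hI
  rw [mon_mem_colon_frobPow_iff] at hγ ⊢
  rintro _ ⟨A, hA, rfl⟩
  obtain ⟨_, ⟨B, hB, rfl⟩, hle⟩ := hγ _ ⟨A, hA, rfl⟩
  refine ⟨_, ⟨B, hB, rfl⟩, fun i => ?_⟩
  have := hle i
  simp only [squarefreeExp, Pi.smul_apply, Pi.add_apply, smul_eq_mul, frobTrunc] at this ⊢
  split_ifs at this ⊢ <;> omega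

theorem IsMinGen.eq_of_le {k : Type*} [Field k] {n : ℕ} {J : Ideal (MvPowerSeries (Fin n) k)}
    {γ δ : Fin n → ℕ} (hγ : IsMinGen k J γ) (hδ : mon k δ ∈ J) (hle : δ ≤ γ) : δ = γ :=
  by_contra fun hne => hγ.2 δ hle hne hδ

/-- The minimal generators of a monomial ideal belong to every monomial generating set. -/
theorem IsMinGen.mem_of_span {k : Type*} [Field k] {n : ℕ} {D : Set (Fin n → ℕ)}
    {γ : Fin n → ℕ} (hγ : IsMinGen k (Ideal.span (mon k '' D)) γ) : γ ∈ D := by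
  obtain ⟨δ, hδ, hle⟩ := mon_mem_span_mon.mp hγ.1
  exact hγ.eq_of_le (Ideal.subset_span ⟨δ, hδ, rfl⟩) hle ▸ hδ

theorem statement7 (p : ℕ) [Fact p.Prime] (k : Type*) [Field k] [CharP k p]
    (n : ℕ) (hn : 0 < n) (r : ℕ) (hr : 0 < r) (α : Fin r → Fin n → ℕ)
    (I : Ideal (MvPowerSeries (Fin n) k)) (hdec : IsMinFaceDecomp k α I)
    (hsum : (⨆ j, faceIdeal k (α j)) =
      Ideal.span (Set.range (MvPowerSeries.X : Fin n → MvPowerSeries (Fin n) k)))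
    (e : ℕ) (hJ : Jideal k (p ^ e) I ≠ ⊥) (γ γ' : Fin n → ℕ)
    (hγ : IsMinGen k (Jideal k (p ^ e) I) γ)
    (hγ' : IsMinGen k (Jideal k (p ^ e) I) γ')
    (hsupp : {i | γ' i ≠ 0} ⊂ {i | γ i ≠ 0}) :
    ∃ l, γ l = p ^ e - 1 ∧ γ' l = p ^ e := by
  obtain ⟨T, hT⟩ := iInf_faceIdeal_eq_span_mon k α
  have htrunc {δ : Fin n → ℕ} (hδ : IsMinGen k (Jideal k (p ^ e) I) δ) (i : Fin n) :
      frobTrunc (p ^ e) (δ i) = δ i := by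
    have hmin := hδ.mem_of_span.1
    exact congrFun (hmin.eq_of_le
      (mon_frobTrunc_mem_colon p k e T (hdec.2.2.1.trans hT) hmin.1)
      fun i => frobTrunc_le _ _) i
  by_contra! hne
  have hle (i : Fin n) : γ' i ≤ γ i := by
    have h₁ := htrunc hγ i
    have h₂ := htrunc hγ' i
    have h₃ := hne i
    have h₄ : γ' i ≠ 0 → γ i ≠ 0 := fun h => hsupp.1 h
    unfold frobTrunc at h₁ h₂
    split_ifs at h₁ h₂ <;> omega
  exact hsupp.ne (by rw [hγ.eq_of_le hγ'.1 hle])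

end
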